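/- Every (P2+P3, gem)-free graph G with ω(G) = 3 satisfies χ(G) ≤ 6. -/

import Mathlib

open SimpleGraph

/-- The graph `P2 + P3` (disjoint union of a path on 2 and a path on 3 vertices). -/
def graphP2P3 : SimpleGraph (Fin 5) :=
  SimpleGraph.fromRel (fun x y => (x, y) ∈ ([(0,1),(2,3),(3,4)] : List (Fin 5 × Fin 5)))

/-- The gem: a path `P4` (0-1-2-3) plus a vertex 4 adjacent to all of it. -/
def graphGem : SimpleGraph (Fin 5) :=
  SimpleGraph.fromRel (fun x y =>
    (x, y) ∈ ([(0,1),(1,2),(2,3),(4,0),(4,1),(4,2),(4,3)] : List (Fin 5 × Fin 5)))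

/-- The path on three vertices. -/
def graphP3 : SimpleGraph (Fin 3) :=
  SimpleGraph.fromRel (fun x y => (x, y) ∈ ([(0,1),(1,2)] : List (Fin 3 × Fin 3)))

/-- The cycle on five vertices. -/
def graphC5 : SimpleGraph (Fin 5) :=
  SimpleGraph.fromRel (fun x y => y = x + 1)

/-- `F1`: a 5-cycle `v1 v2 v3 v4 v5` (vertices 0..4) plus a vertex 5 adjacent
exactly to `v5, v1, v2` (i.e. 4, 0, 1). -/
def graphF1 : SimpleGraph (Fin 6) :=
  SimpleGraph.fromRel (fun x y =>
    (x, y) ∈ ([(0,1),(1,2),(2,3),(3,4),(4,0),(5,4),(5,0),(5,1)] : List (Fin 6 × Fin 6)))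

/-- `F1'`: a 5-cycle (0..4) plus adjacent vertices 5, 6, where 5 is adjacent to 4,0,1
and 6 is adjacent to 0,1,2. -/
def graphF1' : SimpleGraph (Fin 7) :=
  SimpleGraph.fromRel (fun x y =>
    (x, y) ∈ ([(0,1),(1,2),(2,3),(3,4),(4,0),(5,4),(5,0),(5,1),(6,0),(6,1),(6,2),(5,6)] :
      List (Fin 7 × Fin 7)))

/-- `F1''`: a 5-cycle (0..4) plus nonadjacent vertices 5, 6, where 5 is adjacent to 4,0,1
and 6 is adjacent to 1,2,3. -/
def graphF1'' : SimpleGraph (Fin 7) :=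
  SimpleGraph.fromRel (fun x y =>
    (x, y) ∈ ([(0,1),(1,2),(2,3),(3,4),(4,0),(5,4),(5,0),(5,1),(6,1),(6,2),(6,3)] :
      List (Fin 7 × Fin 7)))

/-- `F2`: a 5-cycle (0..4) plus adjacent vertices 5, 6, each adjacent to `v1,v3,v4`
(i.e. 0, 2, 3). -/
def graphF2 : SimpleGraph (Fin 7) :=
  SimpleGraph.fromRel (fun x y =>
    (x, y) ∈ ([(0,1),(1,2),(2,3),(3,4),(4,0),(5,6),(5,0),(5,2),(5,3),(6,0),(6,2),(6,3)] :
      List (Fin 7 × Fin 7)))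

/-- `F3`: a 5-cycle (0..4) plus adjacent vertices 5 (adjacent to 0,2,3) and
6 (adjacent to 2,3). -/
def graphF3 : SimpleGraph (Fin 7) :=
  SimpleGraph.fromRel (fun x y =>
    (x, y) ∈ ([(0,1),(1,2),(2,3),(3,4),(4,0),(5,6),(5,0),(5,2),(5,3),(6,2),(6,3)] :
      List (Fin 7 × Fin 7)))

/-- `G` contains no induced copy of `H`. -/
def IsFreeOf {W V : Type*} (G : SimpleGraph V) (H : SimpleGraph W) : Prop :=
  IsEmpty (H ↪g G)

/-- The disjoint union of a clique blowup `C5⟨K_{t 0},…,K_{t 4}⟩` of the 5-cycle and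
`ℓ` isolated vertices. -/
def blowupC5 (t : Fin 5 → ℕ) (ℓ : ℕ) :
    SimpleGraph ((Σ i : Fin 5, Fin (t i)) ⊕ Fin ℓ) :=
  SimpleGraph.fromRel (fun x y => ∃ a b, x = Sum.inl a ∧ y = Sum.inl b ∧
    (a.1 = b.1 ∨ b.1 = a.1 + 1))

/-- Membership in the class `𝒞`: `G` is isomorphic to the disjoint union of a clique
blowup of `C5` and some number of isolated vertices. -/
def InClassC {V : Type*} (G : SimpleGraph V) : Prop :=
  ∃ (t : Fin 5 → ℕ) (ℓ : ℕ), (∀ i, 0 < t i) ∧ Nonempty (G ≃g blowupC5 t ℓ)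

/-- The function φ from the paper. -/
noncomputable def phi (x : ℕ) : ℕ :=
  if x = 1 then 1 else if x = 2 then 4 else if x = 3 then 6
  else ⌈(5 * (x : ℚ) - 1) / 4⌉₊

section Stmt
variable {V : Type*} (G : SimpleGraph V)

/-- `S` is complete to `S'`. -/
def CompleteTo (S S' : Set V) : Prop := ∀ x ∈ S, ∀ y ∈ S', G.Adj x y

/-- `S` is anticomplete to `S'`. -/
def AnticompleteTo (S S' : Set V) : Prop := ∀ x ∈ S, ∀ y ∈ S', ¬ G.Adj x y

/-- `S` is a stable (independent) set. -/
def IsStableSet (S : Set V) : Prop := S.Pairwise (fun x y => ¬ G.Adj x y)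

/-- A graph is perfect if every induced subgraph has chromatic number equal to
its clique number. -/
def IsPerfect : Prop :=
  ∀ S : Set V, (G.induce S).chromaticNumber = ((G.induce S).cliqueNum : ℕ∞)

variable (v : Fin 5 → V)

/-- `v` induces a `C5` in `G`: two cycle vertices are adjacent iff consecutive. -/
def IsInducedC5 : Prop :=
  Function.Injective v ∧ ∀ i j : Fin 5, G.Adj (v i) (v j) ↔ (j = i + 1 ∨ i = j + 1)

def setA (i : Fin 5) : Set V :=
  {u | u ∉ Set.range v ∧ ∀ j, G.Adj u (v j) ↔ j = i}

def setB (i : Fin 5) : Set V :=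
  {u | u ∉ Set.range v ∧ ∀ j, G.Adj u (v j) ↔ (j = i ∨ j = i + 1)}

def setX (i : Fin 5) : Set V :=
  {u | u ∉ Set.range v ∧ ∀ j, G.Adj u (v j) ↔ (j = i - 1 ∨ j = i + 1)}

def setY (i : Fin 5) : Set V :=
  {u | u ∉ Set.range v ∧ ∀ j, G.Adj u (v j) ↔ (j = i - 1 ∨ j = i ∨ j = i + 1)}

def setZ (i : Fin 5) : Set V :=
  {u | u ∉ Set.range v ∧ ∀ j, G.Adj u (v j) ↔ (j = i - 2 ∨ j = i ∨ j = i + 2)}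

def setT : Set V :=
  {u | u ∉ Set.range v ∧ ∀ j, ¬ G.Adj u (v j)}

end Stmt

namespace SimpleGraph

variable {V : Type*} {G : SimpleGraph V}

lemma colorable_add_of_induce {S T : Set V} {m n : ℕ} (hS : (G.induce S).Colorable m)
    (hT : (G.induce T).Colorable n) (h : ∀ x, x ∈ S ∨ x ∈ T) : G.Colorable (m + n) := by
  classical
  obtain ⟨f⟩ := hS
  obtain ⟨g⟩ := hT
  have hT' : ∀ x, x ∉ S → x ∈ T := fun x hx => (h x).resolve_left hx
  have key : G.Coloring (Fin m ⊕ Fin n) := Coloring.mk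
    (fun x => if hx : x ∈ S then Sum.inl (f ⟨x, hx⟩) else Sum.inr (g ⟨x, hT' x hx⟩)) <| by
      intro a b hab
      by_cases ha : a ∈ S <;> by_cases hb : b ∈ S <;> simp only [ha, hb, dite_true, dite_false,
        ne_eq, Sum.inl.injEq, Sum.inr.injEq, reduceCtorEq, not_false_eq_true]
      · exact f.valid (v := ⟨a, ha⟩) (w := ⟨b, hb⟩) hab
      · exact g.valid (v := ⟨a, hT' a ha⟩) (w := ⟨b, hT' b hb⟩) hab
  simpa using key.colorable

lemma colorable_add_of_induce_compl {S : Set V} {m n : ℕ} (hS : (G.induce S).Colorable m)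
    (hT : (G.induce Sᶜ).Colorable n) : G.Colorable (m + n) :=
  colorable_add_of_induce hS hT fun x => em (x ∈ S)

lemma colorable_induce_add {R S T : Set V} {m n : ℕ} (hS : (G.induce S).Colorable m)
    (hT : (G.induce T).Colorable n) (h : ∀ x ∈ R, x ∈ S ∨ x ∈ T) :
    (G.induce R).Colorable (m + n) := by
  refine colorable_add_of_induce (S := {x : R | (x : V) ∈ S}) (T := {x : R | (x : V) ∈ T})
    ?_ ?_ fun x => h x x.2
  · exact hS.of_hom ⟨fun x => ⟨x.1.1, x.2⟩, fun hab => hab⟩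
  · exact hT.of_hom ⟨fun x => ⟨x.1.1, x.2⟩, fun hab => hab⟩

lemma colorable_one_induce {S : Set V} (h : ∀ a ∈ S, ∀ b ∈ S, ¬ G.Adj a b) :
    (G.induce S).Colorable 1 :=
  ⟨Coloring.mk (fun _ => 0) fun {a b} hab => (h a a.2 b b.2 hab).elim⟩

/-- If any two vertices joined by a walk of length three are adjacent, the graph is bipartite. -/
lemma colorable_two_of_adj_of_walk_three
    (h : ∀ a b c d, G.Adj a b → G.Adj b c → G.Adj c d → G.Adj a d) : G.Colorable 2 := by
  classical
  have near : ∀ r x, G.Reachable r x → r = x ∨ G.Adj r x ∨ ∃ m, G.Adj r m ∧ G.Adj m x := by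
    rintro r x ⟨p⟩
    induction p with
    | nil => exact Or.inl rfl
    | cons hadj _ ih =>
      rcases ih with rfl | ih | ⟨m, h1, h2⟩
      · exact Or.inr (Or.inl hadj)
      · exact Or.inr (Or.inr ⟨_, hadj, ih⟩)
      · exact Or.inr (Or.inl (h _ _ _ _ hadj h1 h2))
  let root : V → V := fun x => (G.connectedComponentMk x).out
  have hroot : ∀ x, G.Reachable (root x) x := fun x =>
    ConnectedComponent.exact (Quot.out_eq (G.connectedComponentMk x))
  have key : G.Coloring Prop := Coloring.mk (fun x => G.Adj (root x) x) <| by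
    intro a b hab heq
    have hr : root a = root b := by
      simp only [root, ConnectedComponent.sound hab.reachable]
    simp only [hr, eq_iff_iff] at heq
    by_cases hb : G.Adj (root b) b
    · exact G.irrefl (h _ _ _ _ (heq.2 hb) hab hb.symm)
    · have ha := mt heq.1 hb
      have := near _ _ (hroot a)
      rw [hr] at this
      rcases this with e | e | ⟨m, h1, h2⟩
      · exact hb (e ▸ hab)
      · exact ha e
      · exact hb (h _ _ _ _ h1 h2 hab)
  simpa using key.colorable

/-- A disjoint union of cliques is coloured with as many colours as its clique number. -/
lemma colorable_of_adj_trans [Finite V] {n : ℕ}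
    (h : ∀ a b c, G.Adj a b → G.Adj b c → a ≠ c → G.Adj a c) (hn : G.CliqueFree (n + 1)) :
    G.Colorable n := by
  classical
  have := Fintype.ofFinite V
  let e := Fintype.equivFin V
  let S : V → Finset V := fun x => {y | G.Adj x y ∧ e y < e x}
  have hcard : ∀ x, (S x).card < n := by
    intro x
    by_contra! hx
    have hxS : x ∉ S x := by simp [S]
    refine hn.mono ?_ (insert x (S x)) ⟨?_, rfl⟩
    · rw [Finset.card_insert_of_notMem hxS]
      omega
    · rw [Finset.coe_insert, isClique_insert]
      refine ⟨fun a ha b hb hab => ?_, fun b hb _ => ?_⟩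
      · simp only [S, Finset.coe_filter, Finset.mem_univ, true_and, Set.mem_ofPred_eq] at ha hb
        exact h _ _ _ ha.1.symm hb.1 hab
      · simp only [S, Finset.coe_filter, Finset.mem_univ, true_and, Set.mem_ofPred_eq] at hb
        exact hb.1
  have lt : ∀ a b, G.Adj a b → e a < e b → (S a).card < (S b).card := by
    intro a b hab hlt
    refine Finset.card_lt_card ⟨fun y hy => ?_, fun hsub => ?_⟩
    · simp only [S, Finset.mem_filter, Finset.mem_univ, true_and] at hy ⊢
      have hlt' := hy.2.trans hlt
      exact ⟨h _ _ _ hab.symm hy.1 (by rintro rfl; exact lt_irrefl _ hlt'), hlt'⟩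
    · have : a ∈ S a := hsub (by simp [S, hab.symm, hlt])
      simp [S] at this
  refine (colorable_iff_exists_bdd_nat_coloring n).2
    ⟨Coloring.mk (fun x => (S x).card) fun {a b} hab => ?_, fun x => hcard x⟩
  rcases lt_or_gt_of_ne (e.injective.ne hab.ne) with hlt | hlt
  · exact (lt a b hab hlt).ne
  · exact (lt b a hab.symm hlt).ne.symm

/-- The hypothesis `P2 + P3`-free, unfolded on vertices. -/
lemma false_of_p2p3 (h : IsFreeOf G graphP2P3) {a b x y z : V} (hab : G.Adj a b)
    (hxy : G.Adj x y) (hyz : G.Adj y z) (hne : x ≠ z) (hxz : ¬ G.Adj x z)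
    (hax : ¬ G.Adj a x) (hay : ¬ G.Adj a y) (haz : ¬ G.Adj a z)
    (hbx : ¬ G.Adj b x) (hby : ¬ G.Adj b y) (hbz : ¬ G.Adj b z) : False := by
  have key : ∀ i j : Fin 5, (![a, b, x, y, z] i = ![a, b, x, y, z] j → i = j) ∧
      (G.Adj (![a, b, x, y, z] i) (![a, b, x, y, z] j) ↔ graphP2P3.Adj i j) := by
    have := hab.ne
    have := hxy.ne
    have := hyz.ne
    have : a ≠ x := by rintro rfl; exact hbx hab.symm
    have : a ≠ y := by rintro rfl; exact hby hab.symm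
    have : a ≠ z := by rintro rfl; exact hbz hab.symm
    have : b ≠ x := by rintro rfl; exact hax hab
    have : b ≠ y := by rintro rfl; exact hay hab
    have : b ≠ z := by rintro rfl; exact haz hab
    intro i j
    fin_cases i <;> fin_cases j <;>
      simp_all [graphP2P3, G.adj_comm, eq_comm]
  exact h.false ⟨⟨![a, b, x, y, z], fun i j => (key i j).1⟩, fun {i j} => (key i j).2⟩

/-- The hypothesis gem-free, unfolded on vertices. -/
lemma false_of_gem (h : IsFreeOf G graphGem) {w x y z v : V} (hwx : G.Adj w x)
    (hxy : G.Adj x y) (hyz : G.Adj y z) (hwy : ¬ G.Adj w y) (hwz : ¬ G.Adj w z)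
    (hxz : ¬ G.Adj x z) (hvw : G.Adj v w) (hvx : G.Adj v x) (hvy : G.Adj v y)
    (hvz : G.Adj v z) (hne : w ≠ y) (hne' : x ≠ z) : False := by
  have key : ∀ i j : Fin 5, (![w, x, y, z, v] i = ![w, x, y, z, v] j → i = j) ∧
      (G.Adj (![w, x, y, z, v] i) (![w, x, y, z, v] j) ↔ graphGem.Adj i j) := by
    have := hwx.ne
    have := hxy.ne
    have := hyz.ne
    have := hvw.ne
    have := hvx.ne
    have := hvy.ne
    have := hvz.ne
    have : w ≠ z := by rintro rfl; exact hwy hyz.symm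
    intro i j
    fin_cases i <;> fin_cases j <;>
      simp_all [graphGem, G.adj_comm, eq_comm]
  exact h.false ⟨⟨![w, x, y, z, v], fun i j => (key i j).1⟩, fun {i j} => (key i j).2⟩

lemma CliqueFree.false_of_four (h : G.CliqueFree 4) {a b c d : V} (hab : G.Adj a b)
    (hac : G.Adj a c) (had : G.Adj a d) (hbc : G.Adj b c) (hbd : G.Adj b d)
    (hcd : G.Adj c d) : False := by
  classical
  exact h {a, b, c, d} ((is3Clique_triple_iff.2 ⟨hbc, hbd, hcd⟩).insert (by
    simp only [Finset.mem_insert, Finset.mem_singleton, forall_eq_or_imp, forall_eq]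
    exact ⟨hab, hac, had⟩))

lemma colorable_two_neighborSet (hgem : IsFreeOf G graphGem) (hK : G.CliqueFree 4) (v : V) :
    (G.induce (G.neighborSet v)).Colorable 2 := by
  refine colorable_two_of_adj_of_walk_three ?_
  rintro ⟨a, ha⟩ ⟨b, hb⟩ ⟨c, hc⟩ ⟨d, hd⟩ hab hbc hcd
  simp only [comap_adj, Function.Embedding.subtype_apply] at *
  by_contra had
  have hac : ¬ G.Adj a c := fun h => hK.false_of_four ha hb hc hab h hbc
  have hbd : ¬ G.Adj b d := fun h => hK.false_of_four hb hc hd hbc h hcd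
  refine false_of_gem hgem hab hbc hcd hac had hbd ha hb hc hd ?_ ?_
  · rintro rfl
    exact had hcd
  · rintro rfl
    exact had hab

/-- The vertices with at least two neighbours among `x`, `y`, `z`. -/
def twoNeighbors (G : SimpleGraph V) (x y z : V) : Set V :=
  {p | (G.Adj p y ∧ G.Adj p z) ∨ (G.Adj p x ∧ G.Adj p z) ∨ (G.Adj p x ∧ G.Adj p y)}

lemma colorable_three_twoNeighbors (hK : G.CliqueFree 4) {x y z : V} (hxy : G.Adj x y)
    (hxz : G.Adj x z) (hyz : G.Adj y z) : (G.induce (G.twoNeighbors x y z)).Colorable 3 := by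
  have stable : ∀ {s t : V}, G.Adj s t →
      (G.induce {p | G.Adj p s ∧ G.Adj p t}).Colorable 1 := fun hst =>
    colorable_one_induce fun a ha b hb hab =>
      hK.false_of_four hab ha.1 ha.2 hb.1 hb.2 hst
  exact colorable_induce_add (stable hyz)
    (colorable_induce_add (R := {p | (G.Adj p x ∧ G.Adj p z) ∨ (G.Adj p x ∧ G.Adj p y)})
      (stable hxz) (stable hxy) fun _ h => h) fun _ h => h

/-- In a `P2 + P3`-free graph, every vertex outside an edge `uv` that has at most one neighbour in
a triangle anticomplete to `uv` is adjacent to both or to none of `u` and `v`. -/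
lemma adj_iff_adj_of_notMem_twoNeighbors (hP : IsFreeOf G graphP2P3) {u v x y z p : V}
    (huv : G.Adj u v) (hxy : G.Adj x y) (hxz : G.Adj x z) (hyz : G.Adj y z)
    (hux : ¬ G.Adj u x) (huy : ¬ G.Adj u y) (huz : ¬ G.Adj u z)
    (hvx : ¬ G.Adj v x) (hvy : ¬ G.Adj v y) (hvz : ¬ G.Adj v z)
    (hp : p ∉ G.twoNeighbors x y z) (hpu : p ≠ u) (hpv : p ≠ v) :
    G.Adj p u ↔ G.Adj p v := by
  have aux : ∀ {u v : V}, G.Adj u v → ¬ G.Adj u x → ¬ G.Adj u y → ¬ G.Adj u z → ¬ G.Adj v x →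
      ¬ G.Adj v y → ¬ G.Adj v z → p ≠ v → G.Adj p u → G.Adj p v := by
    intro u v huv hux huy huz hvx hvy hvz hpv hpu
    by_contra h
    simp only [twoNeighbors, Set.mem_ofPred_eq, not_or, not_and] at hp
    have edge : ∀ {s t : V}, G.Adj s t → ¬ G.Adj u s → ¬ G.Adj u t → ¬ G.Adj v s →
        ¬ G.Adj v t → ¬ G.Adj p s → ¬ G.Adj p t → False :=
      fun hst hus hut hvs hvt hps hpt => false_of_p2p3 hP hst hpu huv hpv h
        (mt Adj.symm hps) (mt Adj.symm hus) (mt Adj.symm hvs)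
        (mt Adj.symm hpt) (mt Adj.symm hut) (mt Adj.symm hvt)
    by_cases h1 : G.Adj p x
    · exact edge hyz huy huz hvy hvz (hp.2.2 h1) (hp.2.1 h1)
    · by_cases h2 : G.Adj p y
      · exact edge hxz hux huz hvx hvz h1 (hp.1 h2)
      · exact edge hxy hux huy hvx hvy h1 h2
  exact ⟨aux huv hux huy huz hvx hvy hvz hpv, aux huv.symm hvx hvy hvz hux huy huz hpu⟩

/-- A `(P2 + P3, K4)`-free graph with two anticomplete triangles is 6-colourable. -/
lemma colorable_six_of_anticomplete_triangles [Finite V] (hP : IsFreeOf G graphP2P3)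
    (hK : G.CliqueFree 4) {u v w x y z : V} (huv : G.Adj u v) (huw : G.Adj u w)
    (hvw : G.Adj v w) (hxy : G.Adj x y) (hxz : G.Adj x z) (hyz : G.Adj y z)
    (hux : ¬ G.Adj u x) (huy : ¬ G.Adj u y) (huz : ¬ G.Adj u z)
    (hvx : ¬ G.Adj v x) (hvy : ¬ G.Adj v y) (hvz : ¬ G.Adj v z)
    (hwx : ¬ G.Adj w x) (hwy : ¬ G.Adj w y) (hwz : ¬ G.Adj w z) : G.Colorable 6 := by
  refine colorable_add_of_induce_compl (colorable_three_twoNeighbors hK hxy hxz hyz)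
    (n := 3) (colorable_of_adj_trans ?_ (hK.comap ⟨(Embedding.induce _).toCopy⟩))
  have anti : ∀ p ∉ G.twoNeighbors x y z, (p = u ∨ p = v ∨ p = w) ∨
      (¬ G.Adj p u ∧ ¬ G.Adj p v ∧ ¬ G.Adj p w) := by
    intro p hp
    by_contra! h
    obtain ⟨⟨h1, h2, h3⟩, h4⟩ := h
    have e1 := adj_iff_adj_of_notMem_twoNeighbors hP huv hxy hxz hyz hux huy huz hvx hvy hvz
      hp h1 h2
    have e2 := adj_iff_adj_of_notMem_twoNeighbors hP huw hxy hxz hyz hux huy huz hwx hwy hwz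
      hp h1 h3
    have hpu : G.Adj p u := by tauto
    exact hK.false_of_four hpu (e1.1 hpu) (e2.1 hpu) huv huw hvw
  rintro ⟨a, ha⟩ ⟨b, hb⟩ ⟨c, hc⟩ hab hbc hac
  simp only [comap_adj, Function.Embedding.subtype_apply, ne_eq, Subtype.mk.injEq] at *
  have step : ∀ {s t : V}, s ∉ G.twoNeighbors x y z → G.Adj t s →
      (t = u ∨ t = v ∨ t = w) → (s = u ∨ s = v ∨ s = w) := by
    intro s t hs hts ht
    refine (anti s hs).resolve_right fun h => ?_
    rcases ht with rfl | rfl | rfl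
    exacts [h.1 hts.symm, h.2.1 hts.symm, h.2.2 hts.symm]
  by_cases hb' : b = u ∨ b = v ∨ b = w
  · have ha' := step ha hab.symm hb'
    have hc' := step hc hbc hb'
    rcases ha' with rfl | rfl | rfl <;> rcases hc' with rfl | rfl | rfl <;>
      first | exact (hac rfl).elim | assumption | (apply Adj.symm; assumption)
  · obtain ⟨b1, b2, -⟩ := (anti b hb).resolve_left hb'
    obtain ⟨a1, a2, -⟩ := (anti a ha).resolve_left (mt (step hb hab) hb')
    obtain ⟨c1, c2, -⟩ := (anti c hc).resolve_left (mt (step hb hbc.symm) hb')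
    by_contra h
    exact false_of_p2p3 hP huv hab hbc hac h (mt Adj.symm a1) (mt Adj.symm b1) (mt Adj.symm c1)
      (mt Adj.symm a2) (mt Adj.symm b2) (mt Adj.symm c2)

/-- If no triangle is anticomplete to some edge of a `(P2 + P3, gem, K4)`-free graph, then the graph
is 6-colourable. -/
lemma colorable_six_of_no_anticomplete_triangle (hP : IsFreeOf G graphP2P3)
    (hgem : IsFreeOf G graphGem) (hK : G.CliqueFree 4) {u v : V} (huv : G.Adj u v)
    (hT : ∀ x y z, G.Adj x y → G.Adj y z → ¬ G.Adj u x → ¬ G.Adj u y → ¬ G.Adj u z →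
      ¬ G.Adj v x → ¬ G.Adj v y → ¬ G.Adj v z → ¬ G.Adj x z) : G.Colorable 6 := by
  refine colorable_add_of_induce_compl (m := 4) (n := 2)
    (colorable_induce_add (R := G.neighborSet u ∪ G.neighborSet v)
      (colorable_two_neighborSet hgem hK u) (colorable_two_neighborSet hgem hK v)
      fun _ h => h) (colorable_two_of_adj_of_walk_three ?_)
  rintro ⟨a, ha⟩ ⟨b, hb⟩ ⟨c, hc⟩ ⟨d, hd⟩ hab hbc hcd
  simp only [comap_adj, Function.Embedding.subtype_apply] at *
  obtain ⟨a1, a2⟩ := not_or.1 ha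
  obtain ⟨b1, b2⟩ := not_or.1 hb
  obtain ⟨c1, c2⟩ := not_or.1 hc
  obtain rfl : a = c := by
    by_contra hac
    exact false_of_p2p3 hP huv hab hbc hac (hT a b c hab hbc a1 b1 c1 a2 b2 c2)
      a1 b1 c1 a2 b2 c2
  exact hcd

/-- If a `(P2 + P3, K4)`-free graph has a triangle `xyz` anticomplete to an edge `uv`, then it is
6-colourable. -/
lemma colorable_six_of_anticomplete_edge_triangle [Finite V] (hP : IsFreeOf G graphP2P3)
    (hK : G.CliqueFree 4) {u v x y z : V} (huv : G.Adj u v)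
    (hxy : G.Adj x y) (hxz : G.Adj x z) (hyz : G.Adj y z)
    (hux : ¬ G.Adj u x) (huy : ¬ G.Adj u y) (huz : ¬ G.Adj u z)
    (hvx : ¬ G.Adj v x) (hvy : ¬ G.Adj v y) (hvz : ¬ G.Adj v z) : G.Colorable 6 := by
  by_contra hcol
  apply hcol
  refine colorable_add_of_induce_compl (n := 3) (colorable_three_twoNeighbors hK hxy hxz hyz) ?_
  have hC : (G.induce {p | G.Adj p u ∧ G.Adj p v}).Colorable 1 :=
    colorable_one_induce fun a ha b hb hab =>
      hK.false_of_four hab ha.1 ha.2 hb.1 hb.2 huv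
  refine colorable_induce_add (m := 1) (n := 2) hC
    (T := {p | p ∉ G.twoNeighbors x y z ∧ ((p = u ∨ p = v) ∨ ¬ G.Adj u p ∧ ¬ G.Adj v p)})
    (colorable_two_of_adj_of_walk_three ?_) ?_
  · rintro ⟨a, ha, ha'⟩ ⟨b, hb, hb'⟩ ⟨c, hc, hc'⟩ ⟨d, hd⟩ hab hbc hcd
    simp only [comap_adj, Function.Embedding.subtype_apply] at *
    obtain rfl : a = c := by
      by_contra hac
      by_cases hbuv : b = u ∨ b = v
      · grind [G.adj_comm, G.irrefl]
      have hb' := hb'.resolve_left hbuv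
      have ha' : ¬ G.Adj u a ∧ ¬ G.Adj v a := ha'.resolve_left (by
        rintro (rfl | rfl)
        exacts [hb'.1 hab, hb'.2 hab])
      have hc' : ¬ G.Adj u c ∧ ¬ G.Adj v c := hc'.resolve_left (by
        rintro (rfl | rfl)
        exacts [hb'.1 hbc.symm, hb'.2 hbc.symm])
      by_cases h : G.Adj a c
      · have anti : ∀ p, p ∉ G.twoNeighbors x y z → ¬ G.Adj u p ∧ ¬ G.Adj v p →
            ¬ G.Adj p x ∧ ¬ G.Adj p y ∧ ¬ G.Adj p z := by
          intro p hp hpuv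
          simp only [twoNeighbors, Set.mem_ofPred_eq, not_or, not_and] at hp
          have path : ∀ {s t : V}, G.Adj s t → ¬ G.Adj u s → ¬ G.Adj u t → ¬ G.Adj v s →
              ¬ G.Adj v t → ¬ G.Adj p t → p ≠ t → ¬ G.Adj p s :=
            fun hst hus hut hvs hvt hpt hne hps => false_of_p2p3 hP huv hps hst hne hpt
              hpuv.1 hus hut hpuv.2 hvs hvt
          have hpx : p ≠ x := by rintro rfl; exact hp.1 hxy hxz
          have hpy : p ≠ y := by rintro rfl; exact hp.2.1 hxy.symm hyz
          have hpz : p ≠ z := by rintro rfl; exact hp.2.2 hxz.symm hyz.symm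
          exact ⟨fun h => path hxy hux huy hvx hvy (hp.2.2 h) hpy h,
            fun h => path hyz huy huz hvy hvz (hp.1 h) hpz h,
            fun h => path hxz.symm huz hux hvz hvx (fun h' => hp.2.1 h' h) hpx h⟩
        obtain ⟨a1, a2, a3⟩ := anti a ha ha'
        obtain ⟨b1, b2, b3⟩ := anti b hb hb'
        obtain ⟨c1, c2, c3⟩ := anti c hc hc'
        exact hcol (colorable_six_of_anticomplete_triangles hP hK hab h hbc hxy hxz hyz
          a1 a2 a3 b1 b2 b3 c1 c2 c3)
      · exact false_of_p2p3 hP huv hab hbc hac h ha'.1 hb'.1 hc'.1 ha'.2 hb'.2 hc'.2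
    exact hcd
  · intro p hp
    have := adj_iff_adj_of_notMem_twoNeighbors hP huv hxy hxz hyz hux huy huz hvx hvy hvz hp
    grind [G.adj_comm]

end SimpleGraph

/-- Every (P2+P3, gem)-free graph `G` with `ω(G) = 3` satisfies `χ(G) ≤ 6`. -/
theorem chi_le_six_of_p2p3_gem_free_omega_three {V : Type*} [Fintype V] (G : SimpleGraph V)
    (h1 : IsFreeOf G graphP2P3) (h2 : IsFreeOf G graphGem)
    (hw : G.cliqueNum = 3) :
    G.chromaticNumber ≤ 6 := by
  classical
  have hK : G.CliqueFree 4 := fun s hs => by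
    have := hs.isClique.card_le_cliqueNum
    rw [hs.card_eq, hw] at this
    omega
  obtain ⟨s, hs⟩ := G.exists_isNClique_cliqueNum
  rw [hw] at hs
  obtain ⟨u, v, -, huv, -⟩ := is3Clique_iff.1 hs
  refine Colorable.chromaticNumber_le (n := 6) ?_
  by_contra hcol
  refine hcol (colorable_six_of_no_anticomplete_triangle h1 h2 hK huv ?_)
  intro x y z hxy hyz hux huy huz hvx hvy hvz hxz
  exact hcol (colorable_six_of_anticomplete_edge_triangle h1 hK huv hxy hxz hyz
    hux huy huz hvx hvy hvz)
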